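/- Let P be a nonzero positive semidefinite complex n×n matrix. Then ‖P‖_cbB = min{ Σⱼ γⱼ : γ ∈ ℝⁿ, γⱼ ≥ 0 for all j, and Δ(γ) − P is positive semidefinite }; the minimum is attained, the optimal vector γ is unique, and for the optimal γ the vector ξ in the cb bilinear form factorization P = Δ(ξ) B Δ(ξ) of P satisfies Δ(ξ)² = (Σⱼ γⱼ)^{-1} Δ(γ). -/

import Mathlib

open Matrix
open scoped ComplexOrder

noncomputable section

namespace MatFact

/-- ℓ² norm of a complex vector. -/
def vnorm {n : ℕ} (v : Fin n → ℂ) : ℝ := Real.sqrt (∑ j, ‖v j‖ ^ 2)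

/-- Operator norm of a matrix as a map ℓ²(Fin n) → ℓ²(Fin m). -/
def opNorm {m n : ℕ} (X : Matrix (Fin m) (Fin n) ℂ) : ℝ :=
  sSup {c : ℝ | ∃ v : Fin n → ℂ, vnorm v ≤ 1 ∧ c = vnorm (X.mulVec v)}

/-- Column norm: the maximal ℓ² norm of a column. -/
def colNorm {m n : ℕ} (X : Matrix (Fin m) (Fin n) ℂ) : ℝ :=
  ⨆ j : Fin n, vnorm (fun i => X i j)

/-- Hilbert–Schmidt (Frobenius) norm. -/
def frobNorm {m n : ℕ} (X : Matrix (Fin m) (Fin n) ℂ) : ℝ :=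
  Real.sqrt (∑ i, ∑ j, ‖X i j‖ ^ 2)

/-- Schur norm: operator norm of Schur (entrywise) multiplication by `X`
on matrices with the operator norm. -/
def schurNorm {m n : ℕ} (X : Matrix (Fin m) (Fin n) ℂ) : ℝ :=
  sSup {c : ℝ | ∃ A : Matrix (Fin m) (Fin n) ℂ, opNorm A ≤ 1 ∧
    c = opNorm (Matrix.hadamard X A)}

/-- The T-norm (bilinear Schur norm). -/
def Tnorm {m n : ℕ} (X : Matrix (Fin m) (Fin n) ℂ) : ℝ :=
  sSup {c : ℝ | ∃ (a : Fin m → ℂ) (B : Matrix (Fin m) (Fin n) ℂ),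
    (∀ i, ‖a i‖ ≤ 1) ∧ opNorm B ≤ 1 ∧
    c = vnorm (fun j => ∑ i, a i * X i j * B i j)}

/-- The F-norm: operator norm of `X` from `ℂⁿ` with the sup norm to `ℂᵐ`
with the ℓ² norm. -/
def Fnorm {m n : ℕ} (X : Matrix (Fin m) (Fin n) ℂ) : ℝ :=
  sSup {c : ℝ | ∃ v : Fin n → ℂ, (∀ j, ‖v j‖ ≤ 1) ∧ c = vnorm (X.mulVec v)}

/-- The bilinear form norm. -/
def Bnorm {m n : ℕ} (Y : Matrix (Fin m) (Fin n) ℂ) : ℝ :=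
  sSup {c : ℝ | ∃ (a : Fin m → ℂ) (b : Fin n → ℂ), (∀ i, ‖a i‖ ≤ 1) ∧
    (∀ j, ‖b j‖ ≤ 1) ∧ c = ‖∑ i, ∑ j, Y i j * a i * b j‖}

/-- The completely bounded F-norm. -/
def cbF {m n : ℕ} (X : Matrix (Fin m) (Fin n) ℂ) : ℝ :=
  sInf {c : ℝ | ∃ (A : Matrix (Fin m) (Fin n) ℂ) (ξ : Fin n → ℂ),
    X = A * Matrix.diagonal ξ ∧ c = opNorm A * vnorm ξ}

/-- The completely bounded bilinear form norm. -/
def cbB {m n : ℕ} (X : Matrix (Fin m) (Fin n) ℂ) : ℝ :=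
  sInf {c : ℝ | ∃ (η : Fin m → ℂ) (B : Matrix (Fin m) (Fin n) ℂ) (ξ : Fin n → ℂ),
    X = Matrix.diagonal η * B * Matrix.diagonal ξ ∧
    c = vnorm η * opNorm B * vnorm ξ}

/-- The range (column space) of a matrix, as a submodule of `ℂᵐ`. -/
def ran {m n : ℕ} (X : Matrix (Fin m) (Fin n) ℂ) : Submodule ℂ (Fin m → ℂ) :=
  LinearMap.range X.mulVecLin

/-- `P` is the orthogonal projection onto the subspace `E`, i.e. `P` is a
Hermitian idempotent with range `E`. -/
def IsOrthProjOnto {n : ℕ} (P : Matrix (Fin n) (Fin n) ℂ)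
    (E : Submodule ℂ (Fin n → ℂ)) : Prop :=
  P.IsHermitian ∧ P * P = P ∧ ran P = E

/-- `W` is a partial isometry with support `E` and range `F`. -/
def IsPartialIsometryFromTo {m n : ℕ} (W : Matrix (Fin m) (Fin n) ℂ)
    (E : Submodule ℂ (Fin n → ℂ)) (F : Submodule ℂ (Fin m → ℂ)) : Prop :=
  IsOrthProjOnto (Wᴴ * W) E ∧ IsOrthProjOnto (W * Wᴴ) F

/-- A cb operator factorization of `X`. -/
def IsCbOpFact {m n : ℕ} (X A : Matrix (Fin m) (Fin n) ℂ) (ξ : Fin n → ℂ) : Prop :=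
  (∀ j, 0 ≤ ξ j) ∧ vnorm ξ = 1 ∧ opNorm A = cbF X ∧
  (∀ j, ξ j = 0 → ∀ i, A i j = 0) ∧ X = A * Matrix.diagonal ξ

/-- A cb bilinear form factorization of `X`. -/
def IsCbBilFact {m n : ℕ} (X : Matrix (Fin m) (Fin n) ℂ) (η : Fin m → ℂ)
    (B : Matrix (Fin m) (Fin n) ℂ) (ξ : Fin n → ℂ) : Prop :=
  (∀ i, 0 ≤ η i) ∧ (∀ j, 0 ≤ ξ j) ∧ vnorm η = 1 ∧ vnorm ξ = 1 ∧
  opNorm B = cbB X ∧ (∀ j, ξ j = 0 → ∀ i, B i j = 0) ∧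
  (∀ i, η i = 0 → ∀ j, B i j = 0) ∧ X = Matrix.diagonal η * B * Matrix.diagonal ξ

/-- A Schur factorization of `X`. -/
def IsSchurFact {m n : ℕ} (X : Matrix (Fin m) (Fin n) ℂ)
    (F : Matrix (Fin m) (Fin m) ℂ) (W : Matrix (Fin m) (Fin n) ℂ)
    (G : Matrix (Fin n) (Fin n) ℂ) : Prop :=
  F.PosSemidef ∧ (∀ i, (F * F) i i ≤ 1) ∧ G.PosSemidef ∧ (∀ j, (G * G) j j ≤ 1) ∧
  IsPartialIsometryFromTo W (ran G) (ran F) ∧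
  X = (schurNorm X : ℂ) • (F * W * G)

/-- A bilinear Schur factorization of `X`. -/
def IsBilinSchurFact {m n : ℕ} (X : Matrix (Fin m) (Fin n) ℂ)
    (T : Matrix (Fin m) (Fin m) ℂ) (W : Matrix (Fin m) (Fin n) ℂ)
    (G : Matrix (Fin n) (Fin n) ℂ) : Prop :=
  T.PosSemidef ∧ frobNorm T = Tnorm X ∧ G.PosSemidef ∧ (∀ j, (G * G) j j ≤ 1) ∧
  IsPartialIsometryFromTo W (ran G) (ran T) ∧ X = T * W * G

/-- Maximal diagonal entry (real part) of a square matrix. -/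
def maxDiag {n : ℕ} (P : Matrix (Fin n) (Fin n) ℂ) : ℝ := ⨆ i, (P i i).re

end MatFact

namespace MatFact

theorem vnorm_nonneg {n : ℕ} (v : Fin n → ℂ) : 0 ≤ vnorm v := Real.sqrt_nonneg _

theorem vnorm_sq {n : ℕ} (v : Fin n → ℂ) : vnorm v ^ 2 = ∑ j, ‖v j‖ ^ 2 :=
  Real.sq_sqrt (Finset.sum_nonneg fun _ _ => sq_nonneg _)

theorem vnorm_eq_norm {n : ℕ} (v : Fin n → ℂ) : vnorm v = ‖WithLp.toLp 2 v‖ := by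
  rw [EuclideanSpace.norm_eq]; rfl

theorem opNorm_eq_norm {n : ℕ} (B : Matrix (Fin n) (Fin n) ℂ) :
    opNorm B = ‖toEuclideanCLM (𝕜 := ℂ) B‖ := by
  rw [← ContinuousLinearMap.sSup_unitClosedBall_eq_norm, opNorm]
  congr 1
  ext c
  constructor
  · rintro ⟨v, hv, rfl⟩
    refine ⟨WithLp.toLp 2 v, by simpa [vnorm_eq_norm] using hv, ?_⟩
    simp [vnorm_eq_norm, toEuclideanCLM_toLp]
  · rintro ⟨v, hv, rfl⟩
    refine ⟨v.ofLp, by simpa [vnorm_eq_norm] using hv, ?_⟩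
    simp [vnorm_eq_norm, ← toEuclideanCLM_toLp]

theorem opNorm_nonneg {n : ℕ} (B : Matrix (Fin n) (Fin n) ℂ) : 0 ≤ opNorm B := by
  rw [opNorm_eq_norm]; exact norm_nonneg _

theorem vnorm_mulVec_le {n : ℕ} (B : Matrix (Fin n) (Fin n) ℂ) (v : Fin n → ℂ) :
    vnorm (B *ᵥ v) ≤ opNorm B * vnorm v := by
  rw [vnorm_eq_norm, vnorm_eq_norm, opNorm_eq_norm, ← toEuclideanCLM_toLp]
  exact ContinuousLinearMap.le_opNorm _ _

theorem opNorm_le_one {n : ℕ} {B : Matrix (Fin n) (Fin n) ℂ}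
    (h : ∀ v, vnorm (B *ᵥ v) ≤ vnorm v) : opNorm B ≤ 1 := by
  refine csSup_le ⟨_, 0, by simp [vnorm], rfl⟩ ?_
  rintro c ⟨v, hv, rfl⟩
  exact (h v).trans hv

theorem norm_star_dotProduct_le {n : ℕ} (y x : Fin n → ℂ) :
    ‖star y ⬝ᵥ x‖ ≤ vnorm y * vnorm x := by
  have h := norm_inner_le_norm (𝕜 := ℂ) (WithLp.toLp 2 y) (WithLp.toLp 2 x)
  rwa [EuclideanSpace.inner_eq_star_dotProduct, dotProduct_comm, ← vnorm_eq_norm,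
    ← vnorm_eq_norm] at h

theorem star_dotProduct_self {n : ℕ} (v : Fin n → ℂ) :
    star v ⬝ᵥ v = ((vnorm v ^ 2 : ℝ) : ℂ) := by
  rw [vnorm_sq]
  simp [dotProduct, Complex.conj_mul']

theorem star_dotProduct_diagonal_mulVec {n : ℕ} (γ : Fin n → ℝ) (x : Fin n → ℂ) :
    star x ⬝ᵥ diagonal (fun j => (γ j : ℂ)) *ᵥ x = ((∑ j, γ j * ‖x j‖ ^ 2 : ℝ) : ℂ) := by
  simp only [dotProduct, mulVec_diagonal, Pi.star_apply, RCLike.star_def]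
  push_cast
  refine Finset.sum_congr rfl fun j _ => ?_
  rw [← Complex.conj_mul']; ring

/-- The matrix `P` is bounded, as a sesquilinear form, by the product of the two weighted
Hilbert seminorms with weights `α ^ 2` and `β ^ 2`. -/
def FormBound {n : ℕ} (P : Matrix (Fin n) (Fin n) ℂ) (α β : Fin n → ℝ) : Prop :=
  ∀ y x : Fin n → ℂ, ‖star y ⬝ᵥ P *ᵥ x‖ ^ 2 ≤
    (∑ j, α j ^ 2 * ‖y j‖ ^ 2) * ∑ j, β j ^ 2 * ‖x j‖ ^ 2

theorem FormBound.norm_apply_sq_le {n : ℕ} {P : Matrix (Fin n) (Fin n) ℂ} {α β : Fin n → ℝ}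
    (h : FormBound P α β) (i j : Fin n) : ‖P i j‖ ^ 2 ≤ α i ^ 2 * β j ^ 2 := by
  have := h (Pi.single i 1) (Pi.single j 1)
  simpa [Pi.single_apply, apply_ite, ← Pi.single_star] using this

theorem posSemidef_diagonal_sub_iff {n : ℕ} {P : Matrix (Fin n) (Fin n) ℂ}
    (hP : P.IsHermitian) (γ : Fin n → ℝ) :
    (diagonal (fun j => (γ j : ℂ)) - P).PosSemidef ↔
      ∀ x : Fin n → ℂ, (star x ⬝ᵥ P *ᵥ x).re ≤ ∑ j, γ j * ‖x j‖ ^ 2 := by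
  have hH : (diagonal (fun j => (γ j : ℂ)) - P).IsHermitian :=
    (isHermitian_diagonal_of_self_adjoint _ (by ext j; simp)).sub hP
  have key (x : Fin n → ℂ) : (star x ⬝ᵥ (diagonal (fun j => (γ j : ℂ)) - P) *ᵥ x).re =
      ∑ j, γ j * ‖x j‖ ^ 2 - (star x ⬝ᵥ P *ᵥ x).re := by
    rw [sub_mulVec, dotProduct_sub, star_dotProduct_diagonal_mulVec, Complex.sub_re,
      Complex.ofReal_re]
  constructor
  · intro h x
    have := h.re_dotProduct_nonneg x
    rw [RCLike.re_eq_complex_re, key] at this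
    linarith
  · intro h
    refine posSemidef_iff_dotProduct_mulVec.2 ⟨hH, fun x => ?_⟩
    rw [Complex.le_def]
    refine ⟨?_, ?_⟩
    · rw [key]; simpa using h x
    · simpa using (hH.im_star_dotProduct_mulVec_self x).symm

open scoped MatrixOrder Matrix.Norms.L2Operator in
theorem exists_eq_conjTranspose_mul_self {n : ℕ} {P : Matrix (Fin n) (Fin n) ℂ}
    (hP : P.PosSemidef) : ∃ G : Matrix (Fin n) (Fin n) ℂ, P = Gᴴ * G :=
  CStarAlgebra.nonneg_iff_eq_star_mul_self.1 hP.nonneg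

/-- Cauchy–Schwarz for the semidefinite form `P`. -/
theorem norm_dotProduct_mulVec_sq_le {n : ℕ} {P : Matrix (Fin n) (Fin n) ℂ}
    (hP : P.PosSemidef) (y x : Fin n → ℂ) :
    ‖star y ⬝ᵥ P *ᵥ x‖ ^ 2 ≤ (star y ⬝ᵥ P *ᵥ y).re * (star x ⬝ᵥ P *ᵥ x).re := by
  obtain ⟨G, rfl⟩ := exists_eq_conjTranspose_mul_self hP
  have key (y x : Fin n → ℂ) :
      star y ⬝ᵥ (Gᴴ * G) *ᵥ x = star (G *ᵥ y) ⬝ᵥ (G *ᵥ x) := by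
    rw [star_mulVec, ← dotProduct_mulVec, mulVec_mulVec]
  rw [key, key, key, star_dotProduct_self, star_dotProduct_self, Complex.ofReal_re,
    Complex.ofReal_re, ← mul_pow]
  exact pow_le_pow_left₀ (norm_nonneg _) (norm_star_dotProduct_le _ _) 2

theorem formBound_of_posSemidef {n : ℕ} {P : Matrix (Fin n) (Fin n) ℂ} (hP : P.PosSemidef)
    {γ γ' : Fin n → ℝ} (hγ : ∀ j, 0 ≤ γ j) (hγ' : ∀ j, 0 ≤ γ' j)
    (h : (diagonal (fun j => (γ j : ℂ)) - P).PosSemidef)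
    (h' : (diagonal (fun j => (γ' j : ℂ)) - P).PosSemidef) :
    FormBound P (fun j => √(γ j)) (fun j => √(γ' j)) := by
  intro y x
  simp only [Real.sq_sqrt (hγ _), Real.sq_sqrt (hγ' _)]
  refine (norm_dotProduct_mulVec_sq_le hP y x).trans ?_
  exact mul_le_mul ((posSemidef_diagonal_sub_iff hP.1 γ).1 h y)
    ((posSemidef_diagonal_sub_iff hP.1 γ').1 h' x) (hP.re_dotProduct_nonneg x)
    (Finset.sum_nonneg fun j _ => mul_nonneg (hγ j) (sq_nonneg _))

theorem dotProduct_diagonal_mul_mul_diagonal {n : ℕ} (B : Matrix (Fin n) (Fin n) ℂ)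
    (η ξ y x : Fin n → ℂ) :
    star y ⬝ᵥ (diagonal η * B * diagonal ξ) *ᵥ x =
      star (fun j => star (η j) * y j) ⬝ᵥ B *ᵥ (fun j => ξ j * x j) := by
  have h1 : (fun j => ξ j * x j) = diagonal ξ *ᵥ x := by ext j; rw [mulVec_diagonal]
  have h2 (w : Fin n → ℂ) : star y ⬝ᵥ diagonal η *ᵥ w =
      star (fun j => star (η j) * y j) ⬝ᵥ w := by
    simp only [dotProduct, mulVec_diagonal, Pi.star_apply, star_mul', star_star]
    exact Finset.sum_congr rfl fun j _ => by ring
  rw [h1, mulVec_mulVec, ← h2, mulVec_mulVec, Matrix.mul_assoc]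

theorem formBound_of_factorization {n : ℕ} (B : Matrix (Fin n) (Fin n) ℂ)
    (η ξ : Fin n → ℂ) :
    FormBound (diagonal η * B * diagonal ξ) (fun j => √(opNorm B) * ‖η j‖)
      (fun j => √(opNorm B) * ‖ξ j‖) := by
  intro y x
  rw [dotProduct_diagonal_mul_mul_diagonal]
  have hB := opNorm_nonneg B
  have h1 := (norm_star_dotProduct_le (fun j => star (η j) * y j)
    (B *ᵥ fun j => ξ j * x j)).trans
      (mul_le_mul_of_nonneg_left (vnorm_mulVec_le _ _) (vnorm_nonneg _))
  refine (pow_le_pow_left₀ (norm_nonneg _) h1 2).trans_eq ?_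
  rw [mul_pow, mul_pow, vnorm_sq, vnorm_sq]
  simp only [mul_pow, Real.sq_sqrt hB, norm_mul, norm_star, mul_assoc, ← Finset.mul_sum]
  ring

/-- If a Hermitian form is bounded by two weighted seminorms, it is dominated by
the diagonal form of their geometric mean. -/
theorem posSemidef_of_formBound {n : ℕ} {P : Matrix (Fin n) (Fin n) ℂ} (hP : P.IsHermitian)
    {α β : Fin n → ℝ} (hα : ∀ j, 0 ≤ α j) (hβ : ∀ j, 0 ≤ β j) (h : FormBound P α β) :
    (diagonal (fun j => ((α j * β j : ℝ) : ℂ)) - P).PosSemidef := by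
  set r : Fin n → ℝ := fun j => √(α j * β j)
  have hr2 (j) : r j * r j = α j * β j := Real.mul_self_sqrt (mul_nonneg (hα j) (hβ j))
  have hzero (i j) (hi : r i = 0) : P i j = 0 := by
    have h0 : α i = 0 ∨ β i = 0 := by
      have := hr2 i; rw [hi] at this; simpa using this.symm
    rcases h0 with h0 | h0
    · have := h.norm_apply_sq_le i j
      rw [h0] at this
      simpa using this
    · have := h.norm_apply_sq_le j i
      rw [h0] at this
      rw [← hP.apply i j]
      simpa using this
  have hzero' (i j) (hj : r j = 0) : P i j = 0 := by
    rw [← hP.apply i j, hzero j i hj, star_zero]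
  set D : Matrix (Fin n) (Fin n) ℂ := diagonal fun j => (((r j)⁻¹ : ℝ) : ℂ) with hD
  set R : Matrix (Fin n) (Fin n) ℂ := diagonal fun j => (r j : ℂ) with hR
  have hDH : Dᴴ = D := by simp [hD, diagonal_conjTranspose]
  have hRH : Rᴴ = R := by simp [hR, diagonal_conjTranspose]
  have hN : (1 - D * P * D).IsHermitian := by
    refine isHermitian_one.sub ?_
    have := isHermitian_conjTranspose_mul_mul D hP
    rwa [hDH] at this
  have hpos : (1 - D * P * D).PosSemidef := by
    rw [hN.posSemidef_iff_eigenvalues_nonneg]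
    intro k
    by_contra hk
    simp only [Pi.zero_apply, not_le] at hk
    have hev := hN.mulVec_eigenvectorBasis k
    set μ := hN.eigenvalues k
    set z : Fin n → ℂ := (hN.eigenvectorBasis k).ofLp
    have hz0 : z ≠ 0 := by
      intro hz
      apply (hN.eigenvectorBasis.orthonormal.ne_zero k)
      exact (WithLp.ofLp_eq_zero 2).1 hz
    set x : Fin n → ℂ := fun j => (((r j)⁻¹ : ℝ) : ℂ) * z j with hx
    have hDz : D *ᵥ z = x := by ext j; rw [hD, mulVec_diagonal]
    have hcomp (j) : (((r j)⁻¹ : ℝ) : ℂ) * (P *ᵥ x) j = ((1 - μ : ℝ) : ℂ) * z j := by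
      have := congrFun hev j
      rw [sub_mulVec, one_mulVec, ← mulVec_mulVec, hDz, ← mulVec_mulVec, Pi.sub_apply, hD,
        mulVec_diagonal, Pi.smul_apply, Complex.real_smul] at this
      push_cast at this ⊢
      linear_combination -this
    have hPx (j) (hj : r j ≠ 0) :
        (P *ᵥ x) j = ((1 - μ : ℝ) : ℂ) * ((α j * β j : ℝ) : ℂ) * x j := by
      have h1 := hcomp j
      have hj' : (r j : ℂ) ≠ 0 := by exact_mod_cast hj
      have hxj : x j = (((r j)⁻¹ : ℝ) : ℂ) * z j := rfl
      rw [← hr2 j, hxj]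
      push_cast at h1 ⊢
      field_simp at h1 ⊢
      linear_combination h1
    set y : Fin n → ℂ := fun j => ((β j / α j : ℝ) : ℂ) * x j with hy
    have hrne {j} (hj : r j ≠ 0) : α j ≠ 0 ∧ β j ≠ 0 := by
      have : α j * β j ≠ 0 := by rw [← hr2 j]; exact mul_ne_zero hj hj
      exact ⟨left_ne_zero_of_mul this, right_ne_zero_of_mul this⟩
    set S : ℝ := ∑ j, β j ^ 2 * ‖x j‖ ^ 2 with hS
    have hxr {j} (hj : r j = 0) : x j = 0 := by simp [hx, hj]
    have hA : ∑ j, α j ^ 2 * ‖y j‖ ^ 2 = S := by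
      refine Finset.sum_congr rfl fun j _ => ?_
      by_cases hj : r j = 0
      · simp [hy, hxr hj]
      · have := (hrne hj).1
        simp only [hy, norm_mul, Complex.norm_real, Real.norm_eq_abs, mul_pow, sq_abs]
        field_simp
    have hyPx : star y ⬝ᵥ P *ᵥ x = (((1 - μ) * S : ℝ) : ℂ) := by
      rw [hS, Finset.mul_sum]
      simp only [dotProduct]
      push_cast
      refine Finset.sum_congr rfl fun j _ => ?_
      by_cases hj : r j = 0
      · simp [hy, hxr hj]
      · have h1 : (α j : ℂ) ≠ 0 := by exact_mod_cast (hrne hj).1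
        rw [hPx j hj, ← Complex.conj_mul']
        simp only [hy, Pi.star_apply, star_mul', RCLike.star_def, Complex.conj_ofReal]
        push_cast
        field_simp
    have hSpos : 0 < S := by
      obtain ⟨j, hj⟩ := Function.ne_iff.1 hz0
      have hrj : r j ≠ 0 := by
        intro h0
        have h1 := hcomp j
        rw [h0] at h1
        simp only [_root_.inv_zero, Complex.ofReal_zero, zero_mul] at h1
        have h2 : ((1 - μ : ℝ) : ℂ) ≠ 0 := by
          have : (1 - μ) ≠ 0 := by linarith
          exact_mod_cast this
        exact (mul_ne_zero h2 hj) h1.symm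
      have hxj : x j ≠ 0 := by
        refine mul_ne_zero ?_ hj
        exact_mod_cast inv_ne_zero hrj
      refine Finset.sum_pos' (fun i _ => by positivity) ⟨j, Finset.mem_univ _, ?_⟩
      have := (hrne hrj).2
      positivity
    have hb := h y x
    rw [hA, ← hS, hyPx, Complex.norm_real, Real.norm_eq_abs, sq_abs, mul_pow] at hb
    have hμ : 1 < (1 - μ) ^ 2 := by nlinarith
    nlinarith [mul_lt_mul_of_pos_right hμ (mul_pos hSpos hSpos)]
  have hfin := hpos.conjTranspose_mul_mul_same R
  rw [hRH] at hfin
  convert hfin using 1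
  rw [Matrix.mul_sub, Matrix.sub_mul, Matrix.mul_one]
  congr 1
  · rw [hR, diagonal_mul_diagonal]
    congr 1; ext j; rw [← hr2 j]; push_cast; rfl
  · ext i j
    simp only [hR, hD, diagonal_mul, mul_diagonal]
    by_cases hi : r i = 0
    · simp [hzero i j hi]
    by_cases hj : r j = 0
    · simp [hzero' i j hj]
    have hi' : (r i : ℂ) ≠ 0 := by exact_mod_cast hi
    have hj' : (r j : ℂ) ≠ 0 := by exact_mod_cast hj
    push_cast
    field_simp


theorem cbB_le_sum {n : ℕ} {P : Matrix (Fin n) (Fin n) ℂ} (hP : P.PosSemidef)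
    {γ : Fin n → ℝ} (hγ : ∀ j, 0 ≤ γ j)
    (h : (diagonal (fun j => (γ j : ℂ)) - P).PosSemidef) : cbB P ≤ ∑ j, γ j := by
  have hF := formBound_of_posSemidef hP hγ hγ h h
  set r : Fin n → ℝ := fun j => √(γ j)
  have hr2 (j) : r j ^ 2 = γ j := Real.sq_sqrt (hγ j)
  set d : Fin n → ℂ := fun j => (((r j)⁻¹ : ℝ) : ℂ) with hd
  set B : Matrix (Fin n) (Fin n) ℂ := diagonal d * P * diagonal d with hB
  have hPB : P = diagonal (fun j => (r j : ℂ)) * B * diagonal (fun j => (r j : ℂ)) := by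
    ext i j
    simp only [hB, diagonal_mul, mul_diagonal, hd]
    by_cases hi : r i = 0
    · have := hF.norm_apply_sq_le i j
      have h0 : P i j = 0 := by simpa [hi] using this
      simp [h0]
    by_cases hj : r j = 0
    · have := hF.norm_apply_sq_le i j
      have h0 : P i j = 0 := by simpa [hj] using this
      simp [h0]
    have hi' : (r i : ℂ) ≠ 0 := by exact_mod_cast hi
    have hj' : (r j : ℂ) ≠ 0 := by exact_mod_cast hj
    push_cast
    field_simp
  have hdle (v : Fin n → ℂ) : ∑ j, r j ^ 2 * ‖d j * v j‖ ^ 2 ≤ vnorm v ^ 2 := by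
    rw [vnorm_sq]
    refine Finset.sum_le_sum fun j _ => ?_
    simp only [hd, norm_mul, Complex.norm_real, Real.norm_eq_abs, mul_pow, sq_abs]
    by_cases hj : r j = 0
    · simp [hj]
    · field_simp; rfl
  have hBle : opNorm B ≤ 1 := by
    refine opNorm_le_one fun v => ?_
    set w := B *ᵥ v with hw
    have hstar (j) : star (d j) = d j := Complex.conj_ofReal _
    have h1 : star w ⬝ᵥ B *ᵥ v =
        star (fun j => d j * w j) ⬝ᵥ P *ᵥ (fun j => d j * v j) := by
      rw [hB, dotProduct_diagonal_mul_mul_diagonal]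
      simp only [hstar]
    have h2 := hF (fun j => d j * w j) (fun j => d j * v j)
    rw [← h1, ← hw, star_dotProduct_self, Complex.norm_real, Real.norm_eq_abs, sq_abs] at h2
    have h3 : (vnorm w ^ 2) ^ 2 ≤ vnorm w ^ 2 * vnorm v ^ 2 :=
      h2.trans (mul_le_mul (hdle w) (hdle v) (Finset.sum_nonneg fun _ _ => by positivity)
        (sq_nonneg _))
    rcases (vnorm_nonneg w).eq_or_lt with h0 | h0
    · rw [← h0]; exact vnorm_nonneg v
    · have h4 : vnorm w ^ 2 ≤ vnorm v ^ 2 := by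
        rw [sq (vnorm w ^ 2)] at h3
        exact le_of_mul_le_mul_left h3 (by positivity)
      exact le_of_sq_le_sq h4 (vnorm_nonneg v)
  have hv : vnorm (fun j => (r j : ℂ)) ^ 2 = ∑ j, γ j := by
    rw [vnorm_sq]; simp [hr2]
  have hle : cbB P ≤ vnorm (fun j => (r j : ℂ)) * opNorm B * vnorm (fun j => (r j : ℂ)) := by
    refine csInf_le ⟨0, ?_⟩ ⟨_, B, _, hPB, rfl⟩
    rintro c ⟨η, B', ξ, -, rfl⟩
    exact mul_nonneg (mul_nonneg (vnorm_nonneg _) (opNorm_nonneg _)) (vnorm_nonneg _)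
  rw [← hv]
  nlinarith [mul_le_mul_of_nonneg_left hBle (sq_nonneg (vnorm (fun j => (r j : ℂ))))]

theorem posSemidef_of_factorization {n : ℕ} {P B : Matrix (Fin n) (Fin n) ℂ}
    {η ξ : Fin n → ℂ} (hP : P.IsHermitian) (h : P = diagonal η * B * diagonal ξ) :
    (diagonal (fun j => ((opNorm B * (‖η j‖ * ‖ξ j‖) : ℝ) : ℂ)) - P).PosSemidef := by
  have hF := formBound_of_factorization B η ξ
  rw [← h] at hF
  convert posSemidef_of_formBound hP (fun j => by positivity) (fun j => by positivity) hF
    using 5 with j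
  rw [mul_mul_mul_comm, Real.mul_self_sqrt (opNorm_nonneg B)]

theorem sum_norm_mul_norm_le {n : ℕ} (η ξ : Fin n → ℂ) :
    ∑ j, ‖η j‖ * ‖ξ j‖ ≤ vnorm η * vnorm ξ := by
  refine le_of_sq_le_sq ?_ (mul_nonneg (vnorm_nonneg _) (vnorm_nonneg _))
  rw [mul_pow, vnorm_sq, vnorm_sq]
  exact Finset.sum_mul_sq_le_sq_mul_sq _ _ _

/-- The set of `γ ≥ 0` with `P ≤ Δ(γ)`. -/
def majorants {n : ℕ} (P : Matrix (Fin n) (Fin n) ℂ) : Set (Fin n → ℝ) :=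
  {γ | (∀ j, 0 ≤ γ j) ∧ (diagonal (fun j => (γ j : ℂ)) - P).PosSemidef}

theorem isClosed_majorants {n : ℕ} {P : Matrix (Fin n) (Fin n) ℂ} (hP : P.IsHermitian) :
    IsClosed (majorants P) := by
  simp only [majorants, posSemidef_diagonal_sub_iff hP, Set.ofPred_and, Set.ofPred_forall]
  refine (isClosed_iInter fun j => ?_).inter (isClosed_iInter fun x => ?_)
  · exact isClosed_le continuous_const (continuous_apply j)
  · exact isClosed_le continuous_const (by fun_prop)

theorem majorants_nonempty {n : ℕ} {P : Matrix (Fin n) (Fin n) ℂ} (hP : P.IsHermitian) :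
    (majorants P).Nonempty := by
  have h : P = diagonal (fun _ => 1) * P * diagonal (fun _ => 1) := by simp
  exact ⟨_, fun j => mul_nonneg (opNorm_nonneg P) (by positivity),
    posSemidef_of_factorization hP h⟩

theorem exists_majorant_sum_le {n : ℕ} {P : Matrix (Fin n) (Fin n) ℂ} (hP : P.IsHermitian) :
    ∃ γ ∈ majorants P, ∀ γ' ∈ majorants P, ∑ j, γ j ≤ ∑ j, γ' j := by
  obtain ⟨γ₀, h₀⟩ := majorants_nonempty hP
  have hcpt : IsCompact (majorants P ∩ Set.Icc 0 (fun _ => ∑ j, γ₀ j)) :=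
    isCompact_Icc.inter_left (isClosed_majorants hP)
  have hmem {γ} (hγ : γ ∈ majorants P) (h : ∑ j, γ j ≤ ∑ j, γ₀ j) :
      γ ∈ majorants P ∩ Set.Icc 0 (fun _ => ∑ j, γ₀ j) :=
    ⟨hγ, hγ.1, fun i => (Finset.single_le_sum (fun j _ => hγ.1 j) (Finset.mem_univ i)).trans h⟩
  obtain ⟨γ, hγ, hmin⟩ := hcpt.exists_isMinOn ⟨γ₀, hmem h₀ le_rfl⟩
    (f := fun γ => ∑ j, γ j) (by fun_prop)
  refine ⟨γ, hγ.1, fun γ' hγ' => ?_⟩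
  by_cases h : ∑ j, γ' j ≤ ∑ j, γ₀ j
  · exact hmin (hmem hγ' h)
  · exact (hmin (hmem h₀ le_rfl)).trans (not_le.1 h).le

theorem cbB_eq_sum {n : ℕ} {P : Matrix (Fin n) (Fin n) ℂ} (hP : P.PosSemidef)
    {γ : Fin n → ℝ} (hγ : γ ∈ majorants P)
    (hmin : ∀ γ' ∈ majorants P, ∑ j, γ j ≤ ∑ j, γ' j) : cbB P = ∑ j, γ j := by
  refine le_antisymm (cbB_le_sum hP hγ.1 hγ.2) ?_
  refine le_csInf ⟨_, fun _ => 1, P, fun _ => 1, by simp, rfl⟩ ?_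
  rintro c ⟨η, B, ξ, h, rfl⟩
  have hB := opNorm_nonneg B
  refine (hmin _ ⟨fun j => by positivity, posSemidef_of_factorization hP.1 h⟩).trans ?_
  rw [← Finset.mul_sum]
  nlinarith [mul_le_mul_of_nonneg_left (sum_norm_mul_norm_le η ξ) hB]

theorem majorant_unique {n : ℕ} {P : Matrix (Fin n) (Fin n) ℂ} (hP : P.PosSemidef)
    {γ γ' : Fin n → ℝ} (hγ : γ ∈ majorants P) (hγ' : γ' ∈ majorants P)
    (h : ∑ j, γ j = cbB P) (h' : ∑ j, γ' j = cbB P) : γ' = γ := by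
  have hG := cbB_le_sum hP (fun j => mul_nonneg (Real.sqrt_nonneg _) (Real.sqrt_nonneg _))
    (posSemidef_of_formBound hP.1 (fun j => Real.sqrt_nonneg _) (fun j => Real.sqrt_nonneg _)
      (formBound_of_posSemidef hP hγ.1 hγ'.1 hγ.2 hγ'.2))
  have hsum : ∑ j, (√(γ j) - √(γ' j)) ^ 2 ≤ 0 := by
    have hexp (j) : (√(γ j) - √(γ' j)) ^ 2 = γ j + γ' j - 2 * (√(γ j) * √(γ' j)) := by
      linear_combination Real.sq_sqrt (hγ.1 j) + Real.sq_sqrt (hγ'.1 j)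
    simp only [hexp, Finset.sum_sub_distrib, Finset.sum_add_distrib, ← Finset.mul_sum]
    linarith
  ext j
  have hz := (Finset.sum_eq_zero_iff_of_nonneg fun j _ => sq_nonneg _).1
    (hsum.antisymm (Finset.sum_nonneg fun j _ => sq_nonneg _)) j (Finset.mem_univ j)
  exact ((Real.sqrt_inj (hγ.1 j) (hγ'.1 j)).1
    (sub_eq_zero.1 (pow_eq_zero_iff two_ne_zero |>.1 hz))).symm

theorem majorant_eq_of_isCbBilFact {n : ℕ} {P B : Matrix (Fin n) (Fin n) ℂ}
    {η ξ : Fin n → ℂ} {γ : Fin n → ℝ} (hP : P.PosSemidef) (hP0 : P ≠ 0)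
    (hγ : γ ∈ majorants P) (h : ∑ j, γ j = cbB P) (hf : IsCbBilFact P η B ξ) (j : Fin n) :
    γ j = (∑ j, γ j) * ‖ξ j‖ ^ 2 ∧ ∑ j, γ j ≠ 0 := by
  obtain ⟨-, -, hη, hξ, hB, -, -, hfac⟩ := hf
  have hle := sum_norm_mul_norm_le η ξ
  rw [hη, hξ, one_mul] at hle
  have hm := posSemidef_of_factorization hP.1 hfac
  have hK := opNorm_nonneg B
  have hmem : (fun j => opNorm B * (‖η j‖ * ‖ξ j‖)) ∈ majorants P :=
    ⟨fun j => by positivity, hm⟩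
  have hge := cbB_le_sum hP hmem.1 hmem.2
  rw [← Finset.mul_sum, ← hB] at hge
  have hK0 : opNorm B ≠ 0 := by
    intro h0
    apply hP0
    ext i j
    have := (formBound_of_factorization B η ξ).norm_apply_sq_le i j
    rw [← hfac] at this
    simpa [h0] using this
  have hKpos : 0 < opNorm B := hK.lt_of_ne hK0.symm
  have hone : ∑ j, ‖η j‖ * ‖ξ j‖ = 1 := le_antisymm hle (by nlinarith)
  have hγeq := majorant_unique hP hγ hmem h (by rw [← Finset.mul_sum, hone, hB, mul_one])
  have hη2 := vnorm_sq η
  have hξ2 := vnorm_sq ξ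
  rw [hη] at hη2
  rw [hξ] at hξ2
  have hsum : ∑ j, (‖η j‖ - ‖ξ j‖) ^ 2 = 0 := by
    have hexp (j) : (‖η j‖ - ‖ξ j‖) ^ 2 = ‖η j‖ ^ 2 + ‖ξ j‖ ^ 2 - 2 * (‖η j‖ * ‖ξ j‖) := by ring
    simp only [hexp, Finset.sum_sub_distrib, Finset.sum_add_distrib, ← Finset.mul_sum]
    linarith
  have hz := (Finset.sum_eq_zero_iff_of_nonneg fun j _ => sq_nonneg _).1 hsum j
    (Finset.mem_univ j)
  have hηξ : ‖η j‖ = ‖ξ j‖ := sub_eq_zero.1 (pow_eq_zero_iff two_ne_zero |>.1 hz)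
  rw [h, ← hB]
  refine ⟨?_, hK0⟩
  rw [← congrFun hγeq j, hηξ, sq]

theorem stmt19 {n : ℕ} (P : Matrix (Fin n) (Fin n) ℂ) (hP : P.PosSemidef)
    (hP0 : P ≠ 0) :
    ∃ γ : Fin n → ℝ, (∀ j, 0 ≤ γ j) ∧
      (Matrix.diagonal (fun j => (γ j : ℂ)) - P).PosSemidef ∧
      cbB P = ∑ j, γ j ∧
      (∀ γ' : Fin n → ℝ, (∀ j, 0 ≤ γ' j) →
        (Matrix.diagonal (fun j => (γ' j : ℂ)) - P).PosSemidef →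
        cbB P ≤ ∑ j, γ' j) ∧
      (∀ γ' : Fin n → ℝ, (∀ j, 0 ≤ γ' j) →
        (Matrix.diagonal (fun j => (γ' j : ℂ)) - P).PosSemidef →
        ∑ j, γ' j = cbB P → γ' = γ) ∧
      (∀ (η : Fin n → ℂ) (B : Matrix (Fin n) (Fin n) ℂ) (ξ : Fin n → ℂ),
        IsCbBilFact P η B ξ →
        Matrix.diagonal ξ * Matrix.diagonal ξ =
          ((∑ j, γ j : ℝ) : ℂ)⁻¹ • Matrix.diagonal (fun j => (γ j : ℂ))) := by
  obtain ⟨γ, hγ, hmin⟩ := exists_majorant_sum_le hP.1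
  have hcb := cbB_eq_sum hP hγ hmin
  refine ⟨γ, hγ.1, hγ.2, hcb, fun γ' h0 h => cbB_le_sum hP h0 h,
    fun γ' h0 h hs => majorant_unique hP hγ ⟨h0, h⟩ hcb.symm hs, fun η B ξ hf => ?_⟩
  rw [diagonal_mul_diagonal, ← diagonal_smul]
  congr 1
  ext j
  obtain ⟨hj, hne⟩ := majorant_eq_of_isCbBilFact hP hP0 hγ hcb.symm hf j
  have hξ : ξ j = (‖ξ j‖ : ℂ) := (RCLike.norm_of_nonneg' (hf.2.1 j)).symm
  rw [Pi.smul_apply, smul_eq_mul, hj, Complex.ofReal_mul, inv_mul_cancel_left₀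
    (by exact_mod_cast hne), hξ]
  push_cast
  simp [sq]

end MatFact
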